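/- If ω ∈ Ω̂ is an r-factorable sequence, then the growth function of the spinal group G_ω satisfies γ_ω(n) ≾ e^{n^α}, where α = log(q^r)/(log(q^r) − log(3/4)). -/

import Mathlib

noncomputable section

open Equiv

namespace Spinal

/-- The letter `q` of the alphabet `{1,…,q}` (here `q = m + 2`). -/
def qtop (m : ℕ) : Fin (m + 2) := Fin.last (m + 1)

/-- The letter `1` of the alphabet. -/
def qone (m : ℕ) : Fin (m + 2) := 0


theorem qone_ne_qtop (m : ℕ) : qone m ≠ qtop m := by
  simp [qone, qtop, Fin.ext_iff]

/-- The action of an alphabet permutation on the first letter of a word. -/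
def rootFun (m : ℕ) (a : Equiv.Perm (Fin (m + 2))) :
    List (Fin (m + 2)) → List (Fin (m + 2))
  | [] => []
  | y :: w => a y :: w

theorem rootFun_leftInv (m : ℕ) (a : Equiv.Perm (Fin (m + 2))) (w : List (Fin (m + 2))) :
    rootFun m a.symm (rootFun m a w) = w := by
  cases w <;> simp [rootFun]

/-- The tree automorphism induced by a root permutation. -/
def rootAut (m : ℕ) (a : Equiv.Perm (Fin (m + 2))) : Equiv.Perm (List (Fin (m + 2))) where
  toFun := rootFun m a
  invFun := rootFun m a.symm
  left_inv w := rootFun_leftInv m a w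
  right_inv w := by simpa using rootFun_leftInv m a.symm w

variable {GB : Type*} [Group GB]

/-- The spinal action of `b : G_B` determined by the sequence `ω` of homomorphisms:
at the vertex `q^n 1` the next letter is moved by `ω n b` (0-indexed, so `ω 0` is the
paper's `ω₁`). -/
def spinalFun (m : ℕ) (ω : ℕ → GB →* Equiv.Perm (Fin (m + 2))) (b : GB) :
    ℕ → List (Fin (m + 2)) → List (Fin (m + 2))
  | _, [] => []
  | n, y :: w =>
    if y = qtop m then y :: spinalFun m ω b (n + 1) w
    else if y = qone m then
      y :: (match w with
            | [] => []
            | z :: w' => ω n b z :: w')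
    else y :: w

theorem spinalFun_leftInv (m : ℕ) (ω : ℕ → GB →* Equiv.Perm (Fin (m + 2)))
    (b : GB) (n : ℕ) (w : List (Fin (m + 2))) :
    spinalFun m ω b⁻¹ n (spinalFun m ω b n w) = w := by
  induction w generalizing n with
  | nil => simp [spinalFun]
  | cons y w ih =>
    by_cases h1 : y = qtop m
    · simp [spinalFun, h1, ih]
    · by_cases h2 : y = qone m
      · match w with
        | [] => simp [spinalFun, h1, h2]
        | z :: w' => simp [spinalFun, h1, h2, map_inv, qone_ne_qtop]
      · simp [spinalFun, h1, h2]

/-- The tree automorphism induced by `b : G_B` via the sequence `ω`. -/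
def spinalAut (m : ℕ) (ω : ℕ → GB →* Equiv.Perm (Fin (m + 2))) (b : GB) :
    Equiv.Perm (List (Fin (m + 2))) where
  toFun := spinalFun m ω b 0
  invFun := spinalFun m ω b⁻¹ 0
  left_inv w := spinalFun_leftInv m ω b 0 w
  right_inv w := by simpa using spinalFun_leftInv m ω b⁻¹ 0 w

/-- The canonical generating set `S_ω = A ∪ B_ω` (non-identity induced automorphisms). -/
def genSet (m : ℕ) (GA : Subgroup (Equiv.Perm (Fin (m + 2))))
    (ω : ℕ → GB →* Equiv.Perm (Fin (m + 2))) : Set (Equiv.Perm (List (Fin (m + 2)))) :=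
  ((rootAut m '' (GA : Set (Equiv.Perm (Fin (m + 2))))) ∪
    Set.range fun b : GB => spinalAut m ω b) \ {1}

/-- The spinal group `G_ω`, as a subgroup of the permutation group of the vertex set
of the `(m+2)`-regular rooted tree. -/
def spinalGroup (m : ℕ) (GA : Subgroup (Equiv.Perm (Fin (m + 2))))
    (ω : ℕ → GB →* Equiv.Perm (Fin (m + 2))) : Subgroup (Equiv.Perm (List (Fin (m + 2)))) :=
  Subgroup.closure (genSet m GA ω)

/-- The defining conditions on the data `(G_A, G_B, ω)` of a spinal group:
`G_A` is a transitive (hence faithful) group of permutations of the alphabet,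
every `ω n` is an epimorphism onto `G_A`, and `ω ∈ Ω̂`: from every index on, the kernels
of the remaining homomorphisms cover `G_B` and intersect trivially. -/
structure SpinalData (m : ℕ) (GA : Subgroup (Equiv.Perm (Fin (m + 2))))
    (ω : ℕ → GB →* Equiv.Perm (Fin (m + 2))) : Prop where
  transitive : ∀ i j : Fin (m + 2), ∃ a ∈ GA, a i = j
  range_eq : ∀ n, (ω n).range = GA
  kernels_cover : ∀ i : ℕ, ∀ b : GB, ∃ j, i ≤ j ∧ ω j b = 1
  kernels_sep : ∀ i : ℕ, ∀ b : GB, (∀ j, i ≤ j → ω j b = 1) → b = 1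

/-- Word length of a group element with respect to a set of generators. -/
def wordLength {G : Type*} [Group G] (S : Set G) (g : G) : ℕ :=
  sInf {n | ∃ l : List G, l.length = n ∧ (∀ x ∈ l, x ∈ S) ∧ l.prod = g}

/-- The word growth function `γ_ω` of the spinal group with respect to `S_ω`. -/
def growth (m : ℕ) (GA : Subgroup (Equiv.Perm (Fin (m + 2))))
    (ω : ℕ → GB →* Equiv.Perm (Fin (m + 2))) (n : ℕ) : ℕ :=
  Nat.card {g : Equiv.Perm (List (Fin (m + 2))) //
    g ∈ spinalGroup m GA ω ∧ wordLength (genSet m GA ω) g ≤ n}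

/-- The period growth function `π_ω`: the largest order of an element of word length
at most `n`. -/
def periodGrowth (m : ℕ) (GA : Subgroup (Equiv.Perm (Fin (m + 2))))
    (ω : ℕ → GB →* Equiv.Perm (Fin (m + 2))) (n : ℕ) : ℕ :=
  sSup (orderOf '' {g : Equiv.Perm (List (Fin (m + 2))) |
    g ∈ spinalGroup m GA ω ∧ wordLength (genSet m GA ω) g ≤ n})

/-- Abstract letters for words over `S_ω`: an `A`-letter is (induced by) a permutation
of the alphabet, a `B`-letter is (induced by) an element of `G_B`. -/
abbrev Letter (m : ℕ) (GB : Type*) := Equiv.Perm (Fin (m + 2)) ⊕ GB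

/-- Evaluation of an abstract letter as a tree automorphism. -/
def evalLetter (m : ℕ) (ω : ℕ → GB →* Equiv.Perm (Fin (m + 2))) :
    Letter m GB → Equiv.Perm (List (Fin (m + 2))) :=
  Sum.elim (rootAut m) (spinalAut m ω)

/-- The list of `A`-letters of a word, in order. -/
def aLetters {m : ℕ} {GB : Type*} : List (Letter m GB) → List (Equiv.Perm (Fin (m + 2))) :=
  List.filterMap fun x => match x with
    | Sum.inl a => some a
    | Sum.inr _ => none

/-- The list of `B`-letters of a word, in order. -/
def bLetters {m : ℕ} {GB : Type*} : List (Letter m GB) → List GB :=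
  List.filterMap fun x => match x with
    | Sum.inl _ => none
    | Sum.inr b => some b

/-- A word is reduced if its letters alternate between `A`-letters and `B`-letters and
no letter is the identity. -/
def IsReduced {m : ℕ} (F : List (Letter m GB)) : Prop :=
  List.Chain' (fun x y => x.isLeft ≠ y.isLeft) F ∧
    Sum.inl (1 : Equiv.Perm (Fin (m + 2))) ∉ F ∧ Sum.inr (1 : GB) ∉ F

open scoped Classical in
/-- One step of the (complete, confluent) simple reduction process: prepend a letter to an
already reduced word and reduce. -/
def reduceStep {m : ℕ} : Letter m GB → List (Letter m GB) → List (Letter m GB)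
  | Sum.inl a, [] => if a = 1 then [] else [Sum.inl a]
  | Sum.inr b, [] => if b = 1 then [] else [Sum.inr b]
  | Sum.inl a, Sum.inl a' :: t => if a * a' = 1 then t else Sum.inl (a * a') :: t
  | Sum.inr b, Sum.inr b' :: t => if b * b' = 1 then t else Sum.inr (b * b') :: t
  | Sum.inl a, y :: t => if a = 1 then y :: t else Sum.inl a :: y :: t
  | Sum.inr b, y :: t => if b = 1 then y :: t else Sum.inr b :: y :: t

/-- The reduced form of a word, obtained by simple reductions. -/
def reduceWord {m : ℕ} (F : List (Letter m GB)) : List (Letter m GB) :=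
  F.foldr reduceStep []

open scoped Classical in
/-- The (unreduced) projection of a word, representing an element of the first-level
stabilizer, to the coordinate `i` of the first level: scanning the word from the left
while accumulating the product `g` of the `A`-letters, a `B`-letter `b` contributes the
letter `b` at the coordinate `g(q)` and the letter `ω₁(b)` at the coordinate `g(1)`. -/
def projWord (m : ℕ) (ω0 : GB →* Equiv.Perm (Fin (m + 2))) (i : Fin (m + 2)) :
    List (Letter m GB) → Equiv.Perm (Fin (m + 2)) → List (Letter m GB)
  | [], _ => []
  | Sum.inl a :: F, g => projWord m ω0 i F (g * a)
  | Sum.inr b :: F, g =>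
      ((if g (qtop m) = i then [Sum.inr b] else []) ++
        (if g (qone m) = i then [Sum.inl (ω0 b)] else [])) ++ projWord m ω0 i F g

/-- The list of the `q^r` (reduced) words at level `r` of the depth-`r` decomposition
of a word. -/
def levelWords (m : ℕ) :
    (ℕ → GB →* Equiv.Perm (Fin (m + 2))) → ℕ → List (Letter m GB) →
      List (List (Letter m GB))
  | _, 0, F => [F]
  | ω, r + 1, F =>
      (List.finRange (m + 2)).flatMap fun i =>
        levelWords m (fun n => ω (n + 1)) r (reduceWord (projWord m (ω 0) i F 1))

/-- `|L_r(F)|`: the total length of level `r` of the depth-`r` decomposition of `F`. -/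
def levelLength (m : ℕ) (ω : ℕ → GB →* Equiv.Perm (Fin (m + 2))) (r : ℕ)
    (F : List (Letter m GB)) : ℕ :=
  ((levelWords m ω r F).map List.length).sum

/-- The triangular weight of a letter: `A`-letters have weight `τ₀ = 1 - η^r`; a
`B`-letter `b` has weight `τ_i = η^r + η^(r-i) - 1` where `i` is the smallest (1-based)
index with `ω_i(b) = 1`. -/
def letterWeight (m : ℕ) (ω : ℕ → GB →* Equiv.Perm (Fin (m + 2))) (η : ℝ) (r : ℕ) :
    Letter m GB → ℝ
  | Sum.inl _ => 1 - η ^ r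
  | Sum.inr b => η ^ r + η ^ (r - (sInf {j | ω j b = 1} + 1)) - 1

/-- The total triangular weight of a word. -/
def wordWeight (m : ℕ) (ω : ℕ → GB →* Equiv.Perm (Fin (m + 2))) (η : ℝ) (r : ℕ)
    (F : List (Letter m GB)) : ℝ :=
  (F.map (letterWeight m ω η r)).sum

/-- The weight `∂^τ(g)` of a group element: the least total weight of a word over `S_ω`
representing it. -/
def elemWeight (m : ℕ) (GA : Subgroup (Equiv.Perm (Fin (m + 2))))
    (ω : ℕ → GB →* Equiv.Perm (Fin (m + 2))) (η : ℝ) (r : ℕ)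
    (g : Equiv.Perm (List (Fin (m + 2)))) : ℝ :=
  sInf {x : ℝ | ∃ F : List (Letter m GB),
    (∀ a : Equiv.Perm (Fin (m + 2)), Sum.inl a ∈ F → a ∈ GA) ∧
    (F.map (evalLetter m ω)).prod = g ∧ wordWeight m ω η r F = x}

/-- `g` acts by `σ` on the first letter of a word and by `h y` on the subtree at `y`. -/
def HasSections {m : ℕ} (g : Equiv.Perm (List (Fin (m + 2)))) (σ : Equiv.Perm (Fin (m + 2)))
    (h : Fin (m + 2) → Equiv.Perm (List (Fin (m + 2)))) : Prop :=
  g [] = [] ∧ ∀ y w, g (y :: w) = σ y :: h y w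

theorem HasSections.unique {m : ℕ} {g g' : Equiv.Perm (List (Fin (m + 2)))}
    {σ : Equiv.Perm (Fin (m + 2))} {h : Fin (m + 2) → Equiv.Perm (List (Fin (m + 2)))}
    (hg : HasSections g σ h) (hg' : HasSections g' σ h) : g = g' := by
  ext1 w
  cases w with
  | nil => rw [hg.1, hg'.1]
  | cons y w => rw [hg.2, hg'.2]

theorem HasSections.mul {m : ℕ} {g g' : Equiv.Perm (List (Fin (m + 2)))}
    {σ σ' : Equiv.Perm (Fin (m + 2))} {h h' : Fin (m + 2) → Equiv.Perm (List (Fin (m + 2)))}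
    (hg : HasSections g σ h) (hg' : HasSections g' σ' h') :
    HasSections (g * g') (σ * σ') (fun y => h (σ' y) * h' y) := by
  refine ⟨?_, fun y w => ?_⟩
  · rw [Equiv.Perm.mul_apply, hg'.1, hg.1]
  · rw [Equiv.Perm.mul_apply, hg'.2, hg.2]
    rfl

theorem hasSections_rootAut (m : ℕ) (a : Equiv.Perm (Fin (m + 2))) :
    HasSections (rootAut m a) a (fun _ => 1) :=
  ⟨rfl, fun _ _ => rfl⟩

theorem rootAut_mul (m : ℕ) (a b : Equiv.Perm (Fin (m + 2))) :
    rootAut m (a * b) = rootAut m a * rootAut m b := by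
  refine (hasSections_rootAut m (a * b)).unique ?_
  simpa using (hasSections_rootAut m a).mul (hasSections_rootAut m b)

theorem rootAut_one (m : ℕ) : rootAut m 1 = 1 := by
  refine (hasSections_rootAut m 1).unique ⟨rfl, fun _ _ => rfl⟩

theorem spinalFun_succ (m : ℕ) (ω : ℕ → GB →* Equiv.Perm (Fin (m + 2))) (b : GB) (n : ℕ)
    (w : List (Fin (m + 2))) :
    spinalFun m ω b (n + 1) w = spinalFun m (fun k => ω (k + 1)) b n w := by
  induction w generalizing n with
  | nil => simp [spinalFun]
  | cons y w ih => simp only [spinalFun, ih]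

theorem spinalFun_mul (m : ℕ) (ω : ℕ → GB →* Equiv.Perm (Fin (m + 2))) (b c : GB) (n : ℕ)
    (w : List (Fin (m + 2))) :
    spinalFun m ω (b * c) n w = spinalFun m ω b n (spinalFun m ω c n w) := by
  induction w generalizing n with
  | nil => simp [spinalFun]
  | cons y w ih =>
    by_cases h1 : y = qtop m
    · simp [spinalFun, h1, ih]
    · by_cases h2 : y = qone m
      · cases w <;> simp [spinalFun, h2, qone_ne_qtop]
      · simp [spinalFun, h1, h2]

theorem spinalAut_mul (m : ℕ) (ω : ℕ → GB →* Equiv.Perm (Fin (m + 2))) (b c : GB) :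
    spinalAut m ω (b * c) = spinalAut m ω b * spinalAut m ω c := by
  ext1 w
  exact spinalFun_mul m ω b c 0 w

theorem hasSections_spinalAut (m : ℕ) (ω : ℕ → GB →* Equiv.Perm (Fin (m + 2))) (b : GB) :
    HasSections (spinalAut m ω b) 1 (fun y =>
      if y = qtop m then spinalAut m (fun k => ω (k + 1)) b
      else if y = qone m then rootAut m (ω 0 b) else 1) := by
  refine ⟨rfl, fun y w => ?_⟩
  change spinalFun m ω b 0 (y :: w) = _
  by_cases h1 : y = qtop m
  · simp only [spinalFun, h1, if_true, spinalFun_succ]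
    rfl
  · by_cases h2 : y = qone m
    · subst h2
      simp only [spinalFun, h1, if_true, if_false]
      cases w <;> rfl
    · simp [spinalFun, h1, h2]

/-- The automorphism `a₁ b₁ a₂ b₂ ⋯ aₙ bₙ e` represented by an alternating word. -/
def altEval {m : ℕ} (ω : ℕ → GB →* Equiv.Perm (Fin (m + 2)))
    (l : List (Equiv.Perm (Fin (m + 2)) × GB)) (e : Equiv.Perm (Fin (m + 2))) :
    Equiv.Perm (List (Fin (m + 2))) :=
  (l.map fun p => rootAut m p.1 * spinalAut m ω p.2).prod * rootAut m e

theorem altEval_cons {m : ℕ} (ω : ℕ → GB →* Equiv.Perm (Fin (m + 2)))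
    (p : Equiv.Perm (Fin (m + 2)) × GB) (l : List (Equiv.Perm (Fin (m + 2)) × GB))
    (e : Equiv.Perm (Fin (m + 2))) :
    altEval ω (p :: l) e = rootAut m p.1 * spinalAut m ω p.2 * altEval ω l e := by
  simp [altEval, mul_assoc]

/-- `g` is represented by an alternating word of `B`-weight at most `W` that is obtained from a
word with `n` nontrivial `A`-letters by merging adjacent `B`-letters. -/
def MergedRep {m : ℕ} (ω : ℕ → GB →* Equiv.Perm (Fin (m + 2))) (wt : GB → ℝ)
    (g : Equiv.Perm (List (Fin (m + 2)))) (n W : ℝ) : Prop :=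
  ∃ (l : List (Equiv.Perm (Fin (m + 2)) × GB)) (e : Equiv.Perm (Fin (m + 2))),
    altEval ω l e = g ∧
    ((l.length : ℝ) ≤ n ∨ ∃ b t, l = (1, b) :: t ∧ (t.length : ℝ) ≤ n) ∧
    (l.map fun p => wt p.2).sum ≤ W

theorem mergedRep_one {m : ℕ} (ω : ℕ → GB →* Equiv.Perm (Fin (m + 2))) (wt : GB → ℝ) :
    MergedRep ω wt (1 : Equiv.Perm (List (Fin (m + 2)))) 0 0 :=
  ⟨[], 1, by simp [altEval, rootAut_one], by simp, by simp⟩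

open scoped Classical in
theorem MergedRep.rootAut_mul {m : ℕ} {ω : ℕ → GB →* Equiv.Perm (Fin (m + 2))} {wt : GB → ℝ}
    {g : Equiv.Perm (List (Fin (m + 2)))} {n W : ℝ} (h : MergedRep ω wt g n W)
    (c : Equiv.Perm (Fin (m + 2))) :
    MergedRep ω wt (rootAut m c * g) (n + if c = 1 then 0 else 1) W := by
  by_cases hc : c = 1
  · simpa [hc, rootAut_one] using h
  obtain ⟨l, e, rfl, hn, hW⟩ := h
  rw [if_neg hc]
  have hn' : (l.length : ℝ) ≤ n + 1 := by
    rcases hn with hn | ⟨b, t, rfl, ht⟩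
    · linarith
    · push_cast [List.length_cons]
      linarith
  cases l with
  | nil => exact ⟨[], c * e, by simp [altEval, Spinal.rootAut_mul], Or.inl hn', hW⟩
  | cons p t =>
    refine ⟨(c * p.1, p.2) :: t, e, ?_, Or.inl (by simpa using hn'), by simpa using hW⟩
    simp [altEval_cons, Spinal.rootAut_mul, mul_assoc]

theorem MergedRep.spinalAut_mul {m : ℕ} {ω : ℕ → GB →* Equiv.Perm (Fin (m + 2))} {wt : GB → ℝ}
    (hwt : ∀ b, 1 ≤ wt b ∧ wt b ≤ 2)
    {g : Equiv.Perm (List (Fin (m + 2)))} {n W : ℝ} (h : MergedRep ω wt g n W) (b : GB) :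
    MergedRep ω wt (spinalAut m ω b * g) n (W + wt b) := by
  obtain ⟨l, e, rfl, hn, hW⟩ := h
  rcases hn with hn | ⟨c, t, rfl, ht⟩
  · refine ⟨(1, b) :: l, e, by simp [altEval_cons, rootAut_one], Or.inr ⟨b, l, rfl, hn⟩, ?_⟩
    simp only [List.map_cons, List.sum_cons]
    linarith
  · refine ⟨(1, b * c) :: t, e, ?_, Or.inr ⟨_, t, rfl, ht⟩, ?_⟩
    · simp [altEval_cons, rootAut_one, Spinal.spinalAut_mul, mul_assoc]
    · simp only [List.map_cons, List.sum_cons] at hW ⊢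
      linarith [(hwt b).1, (hwt c).1, (hwt (b * c)).2]

open scoped Classical in
theorem exists_sections_mergedRep {m : ℕ} (ω : ℕ → GB →* Equiv.Perm (Fin (m + 2))) {wt : GB → ℝ}
    (hwt : ∀ b, 1 ≤ wt b ∧ wt b ≤ 2) (l : List (Equiv.Perm (Fin (m + 2)) × GB))
    (e : Equiv.Perm (Fin (m + 2))) :
    ∃ (σ : Equiv.Perm (Fin (m + 2))) (h : Fin (m + 2) → Equiv.Perm (List (Fin (m + 2))))
      (n W : Fin (m + 2) → ℝ), HasSections (altEval ω l e) σ h ∧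
      (∀ y, MergedRep (fun k => ω (k + 1)) wt (h y) (n y) (W y)) ∧
      ∑ y, n y = (l.map fun p => if ω 0 p.2 = 1 then (0 : ℝ) else 1).sum ∧
      ∑ y, W y = (l.map fun p => wt p.2).sum := by
  induction l with
  | nil =>
    exact ⟨e, fun _ => 1, fun _ => 0, fun _ => 0,
      by simpa [altEval] using hasSections_rootAut m e, fun _ => mergedRep_one _ _,
      by simp, by simp⟩
  | cons p t ih =>
    obtain ⟨σ, h, n, W, hs, hrep, hn, hW⟩ := ih
    obtain ⟨a, b⟩ := p
    have hsum (z : Fin (m + 2)) (x : ℝ) : ∑ y, (if σ y = z then x else 0) = x := by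
      rw [Equiv.sum_comp σ (fun y => if y = z then x else 0)]
      simp
    have hsec := ((hasSections_rootAut m a).mul (hasSections_spinalAut m ω b)).mul hs
    refine ⟨_, _, fun y => n y + if σ y = qone m then (if ω 0 b = 1 then 0 else 1) else 0,
      fun y => W y + if σ y = qtop m then wt b else 0,
      (altEval_cons ω (a, b) t e).symm ▸ hsec, fun y => ?_, ?_, ?_⟩
    · by_cases h1 : σ y = qtop m
      · simpa [h1, (qone_ne_qtop m).symm] using (hrep y).spinalAut_mul hwt b
      · by_cases h2 : σ y = qone m
        · simpa [h2, qone_ne_qtop m] using (hrep y).rootAut_mul (ω 0 b)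
        · simpa [h1, h2] using hrep y
    · rw [Finset.sum_add_distrib, hn, hsum, List.map_cons, List.sum_cons, add_comm]
    · rw [Finset.sum_add_distrib, hW, hsum, List.map_cons, List.sum_cons, add_comm]

/-- `g` decomposes at depth `d` into automorphisms satisfying `P` with total cost at most `M`. -/
def Decomposes {m : ℕ} (P : ℝ → Equiv.Perm (List (Fin (m + 2))) → Prop) :
    ℕ → ℝ → Equiv.Perm (List (Fin (m + 2))) → Prop
  | 0, M, g => P M g
  | d + 1, M, g => ∃ (σ : Equiv.Perm (Fin (m + 2)))
      (h : Fin (m + 2) → Equiv.Perm (List (Fin (m + 2)))) (n : Fin (m + 2) → ℝ),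
      HasSections g σ h ∧ ∑ y, n y ≤ M ∧ ∀ y, Decomposes P d (n y) (h y)

theorem Decomposes.mono {m : ℕ} {P : ℝ → Equiv.Perm (List (Fin (m + 2))) → Prop}
    (hP : ∀ M M' g, M ≤ M' → P M g → P M' g) {d : ℕ} {M M' : ℝ} (hM : M ≤ M')
    {g : Equiv.Perm (List (Fin (m + 2)))} (h : Decomposes P d M g) : Decomposes P d M' g := by
  cases d with
  | zero => exact hP M M' g hM h
  | succ d =>
    obtain ⟨σ, s, n, hs, hn, hd⟩ := h
    exact ⟨σ, s, n, hs, hn.trans hM, hd⟩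

theorem Decomposes.refine {m : ℕ} {P P' : ℝ → Equiv.Perm (List (Fin (m + 2))) → Prop}
    {e : ℕ} {a b : ℝ} (ha : 0 ≤ a)
    (hP : ∀ M g, P M g → Decomposes P' e (a * M + b) g) {d : ℕ} {M : ℝ}
    {g : Equiv.Perm (List (Fin (m + 2)))} (h : Decomposes P d M g) :
    Decomposes P' (e + d) (a * M + b * (m + 2 : ℝ) ^ d) g := by
  induction d generalizing M g with
  | zero => simpa using hP M g h
  | succ d ih =>
    obtain ⟨σ, s, n, hs, hn, hd⟩ := h
    refine ⟨σ, s, fun y => a * n y + b * (m + 2 : ℝ) ^ d, hs, ?_, fun y => ih (hd y)⟩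
    rw [Finset.sum_add_distrib, ← Finset.mul_sum]
    simp only [Finset.sum_const, Finset.card_univ, Fintype.card_fin, nsmul_eq_mul]
    push_cast
    have := mul_le_mul_of_nonneg_left hn ha
    rw [pow_succ]
    linarith

/-- `g` is represented by an alternating word whose `B`-letters have total weight at most `M`. -/
def WeightRep {m : ℕ} (ω : ℕ → GB →* Equiv.Perm (Fin (m + 2))) (wt : GB → ℝ) (M : ℝ)
    (g : Equiv.Perm (List (Fin (m + 2)))) : Prop :=
  ∃ (l : List (Equiv.Perm (Fin (m + 2)) × GB)) (e : Equiv.Perm (Fin (m + 2))),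
    altEval ω l e = g ∧ (l.map fun p => wt p.2).sum ≤ M

theorem WeightRep.mono {m : ℕ} {ω : ℕ → GB →* Equiv.Perm (Fin (m + 2))} {wt : GB → ℝ}
    (M M' : ℝ) (g : Equiv.Perm (List (Fin (m + 2)))) (hM : M ≤ M') (h : WeightRep ω wt M g) :
    WeightRep ω wt M' g := by
  obtain ⟨l, e, hg, hl⟩ := h
  exact ⟨l, e, hg, hl.trans hM⟩

open scoped Classical in
/-- Weight of a `B`-letter inside a block of `ω`: letters already met by a kernel are heavier. -/
def blockWeight (D : Set GB) (b : GB) : ℝ := if b ∈ D then 3 else 2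

theorem WeightRep.decomposes_one {m : ℕ} {ω : ℕ → GB →* Equiv.Perm (Fin (m + 2))} {D : Set GB}
    {M : ℝ} {g : Equiv.Perm (List (Fin (m + 2)))} (h : WeightRep ω (blockWeight D) M g) :
    Decomposes (WeightRep (fun k => ω (k + 1)) (blockWeight (D ∪ {b | ω 0 b = 1}))) 1
      (M + (m + 2)) g := by
  classical
  obtain ⟨l, e, rfl, hl⟩ := h
  set D' := D ∪ {b | ω 0 b = 1} with hD'
  have hwt (b : GB) : 1 ≤ blockWeight D' b - 1 ∧ blockWeight D' b - 1 ≤ 2 := by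
    unfold blockWeight
    split_ifs <;> norm_num
  obtain ⟨σ, h, n, W, hs, hrep, hn, hW⟩ := exists_sections_mergedRep ω hwt l e
  refine ⟨σ, h, fun y => n y + 1 + W y, hs, ?_, fun y => ?_⟩
  · rw [Finset.sum_add_distrib, Finset.sum_add_distrib, hn, hW]
    have key : (l.map fun p => if ω 0 p.2 = 1 then (0 : ℝ) else 1).sum +
        (l.map fun p => blockWeight D' p.2 - 1).sum ≤
        (l.map fun p => blockWeight D p.2).sum := by
      rw [← List.sum_map_add]
      refine List.sum_le_sum fun p _ => ?_
      unfold blockWeight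
      by_cases h0 : ω 0 p.2 = 1 <;> by_cases h1 : p.2 ∈ D <;> norm_num [hD', h0, h1]
    simp only [Finset.sum_const, Finset.card_univ, Fintype.card_fin, nsmul_eq_mul]
    push_cast
    linarith
  · obtain ⟨l', e', hg, hlen, hw⟩ := hrep y
    refine ⟨l', e', hg, ?_⟩
    have hlen' : (l'.length : ℝ) ≤ n y + 1 := by
      rcases hlen with hlen | ⟨b, t, rfl, ht⟩
      · linarith
      · push_cast [List.length_cons]
        linarith
    have hsplit : (l'.map fun p => blockWeight D' p.2).sum =
        (l'.map fun p => blockWeight D' p.2 - 1).sum + l'.length := by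
      clear hg hlen hw hlen'
      induction l' with
      | nil => simp
      | cons p t ih =>
        simp only [List.map_cons, List.sum_cons, ih, List.length_cons]
        push_cast
        ring
    rw [hsplit]
    linarith

theorem WeightRep.decomposes_block {m : ℕ} {ω : ℕ → GB →* Equiv.Perm (Fin (m + 2))}
    {M : ℝ} {g : Equiv.Perm (List (Fin (m + 2)))} (h : WeightRep ω (blockWeight ∅) M g) (e : ℕ) :
    Decomposes (WeightRep (fun k => ω (k + e)) (blockWeight {b | ∃ j < e, ω j b = 1})) e
      (M + 2 * (m + 2 : ℝ) ^ e) g := by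
  induction e with
  | zero =>
    have : {b : GB | ∃ j < 0, ω j b = 1} = ∅ := by simp
    rw [this]
    exact WeightRep.mono _ _ g (by norm_num) h
  | succ e ih =>
    have hstep := Decomposes.refine (a := 1) (b := m + 2) zero_le_one (fun M' g' h' => by
      rw [one_mul]
      exact WeightRep.decomposes_one h') ih
    have hD : {b | ∃ j < e, ω j b = 1} ∪ {b | ω (0 + e) b = 1} =
        {b : GB | ∃ j < e + 1, ω j b = 1} := by
      ext b
      simp only [Set.mem_union, Set.mem_ofPred_eq, zero_add, Nat.lt_succ_iff_lt_or_eq]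
      constructor
      · rintro (⟨j, hj, hb⟩ | hb)
        exacts [⟨j, Or.inl hj, hb⟩, ⟨e, Or.inr rfl, hb⟩]
      · rintro ⟨j, hj | rfl, hb⟩
        exacts [Or.inl ⟨j, hj, hb⟩, Or.inr hb]
    have hω : (fun k => ω (k + 1 + e)) = fun k => ω (k + (e + 1)) := by
      funext k
      congr 1
      omega
    rw [hD, hω, add_comm 1 e] at hstep
    refine hstep.mono WeightRep.mono ?_
    have : (0 : ℝ) ≤ m * (m + 2 : ℝ) ^ e := by positivity
    rw [pow_succ]
    nlinarith

theorem weightRep_const_iff {m : ℕ} {ω : ℕ → GB →* Equiv.Perm (Fin (m + 2))} {wt : GB → ℝ}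
    {c : ℝ} (hc : 0 < c) (hwt : ∀ b, wt b = c) {M : ℝ} {g : Equiv.Perm (List (Fin (m + 2)))} :
    WeightRep ω wt (c * M) g ↔ WeightRep ω (fun _ => 1) M g := by
  simp [WeightRep, hwt, mul_comm _ c, mul_le_mul_iff_right₀ hc]

theorem WeightRep.decomposes_complete_block {m : ℕ} {ω : ℕ → GB →* Equiv.Perm (Fin (m + 2))}
    {e : ℕ} (he : ∀ b, ∃ j < e, ω j b = 1) {M : ℝ} {g : Equiv.Perm (List (Fin (m + 2)))}
    (h : WeightRep ω (fun _ => 1) M g) :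
    Decomposes (WeightRep (fun k => ω (k + e)) (fun _ => 1)) e
      (2 / 3 * M + 2 / 3 * (m + 2 : ℝ) ^ e) g := by
  have h2 := (weightRep_const_iff (wt := blockWeight (∅ : Set GB)) two_pos
    (fun b => by simp [blockWeight])).2 h
  have h3 := Decomposes.refine (a := 1 / 3) (b := 0) (e := 0)
    (P' := WeightRep (fun k => ω (k + e)) (fun _ => 1)) (by norm_num) (fun M' g' h' => by
      refine (weightRep_const_iff (wt := blockWeight {b | ∃ j < e, ω j b = 1}) (c := 3)
        (by norm_num) (fun b => by simp [blockWeight, he b])).1 ?_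
      convert h' using 1
      ring) (h2.decomposes_block e)
  rw [zero_add] at h3
  refine h3.mono WeightRep.mono (le_of_eq ?_)
  ring

theorem WeightRep.decomposes_factorable {m : ℕ} {ω : ℕ → GB →* Equiv.Perm (Fin (m + 2))}
    {t : ℕ → ℕ} (ht0 : t 0 = 0) (ht : StrictMono t)
    (hcomp : ∀ i : ℕ, ∀ b : GB, ∃ j, t i ≤ j ∧ j < t (i + 1) ∧ ω j b = 1)
    {M : ℝ} {g : Equiv.Perm (List (Fin (m + 2)))} (h : WeightRep ω (fun _ => 1) M g) (L : ℕ) :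
    Decomposes (WeightRep (fun k => ω (k + t L)) (fun _ => 1)) (t L)
      ((2 / 3) ^ L * M + 2 * (m + 2 : ℝ) ^ t L) g := by
  induction L with
  | zero =>
    rw [ht0]
    exact WeightRep.mono _ _ g (by norm_num) h
  | succ L ih =>
    obtain ⟨e, he⟩ := Nat.exists_eq_add_of_lt (ht (Nat.lt_succ_self L))
    have he' : t (L + 1) = (e + 1) + t L := by rw [he]; ring
    have hstep := Decomposes.refine (a := 2 / 3) (b := 2 / 3 * (m + 2 : ℝ) ^ (e + 1))
      (by norm_num) (fun M' g' h' => by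
        refine WeightRep.decomposes_complete_block (fun b => ?_) h'
        obtain ⟨j, hj, hj', hb⟩ := hcomp L b
        refine ⟨j - t L, by omega, ?_⟩
        rwa [Nat.sub_add_cancel hj]) ih
    have hω : (fun k => ω (k + (e + 1) + t L)) = fun k => ω (k + t (L + 1)) := by
      funext k
      rw [he', add_assoc]
    rw [hω, ← he'] at hstep
    refine hstep.mono WeightRep.mono ?_
    have h1 : (m + 2 : ℝ) ^ t (L + 1) = (m + 2 : ℝ) ^ (e + 1) * (m + 2 : ℝ) ^ t L := by
      rw [he', pow_add]
    have h2 : (m + 2 : ℝ) ^ t L ≤ (m + 2 : ℝ) ^ t (L + 1) :=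
      pow_le_pow_right₀ (by linarith [(Nat.cast_nonneg m : (0 : ℝ) ≤ m)]) (ht.monotone L.le_succ)
    rw [mul_assoc (2 / 3), ← h1, pow_succ (2 / 3 : ℝ)]
    linarith

theorem sum_pow_length_le {α : Type*} [Fintype α] {z : ℝ} (hz : 0 ≤ z)
    (hzα : z * Fintype.card α ≤ 1 / 2) (T : Finset (List α)) :
    ∑ l ∈ T, z ^ l.length ≤ 2 := by
  classical
  obtain ⟨N, hN⟩ : ∃ N, ∀ l ∈ T, l.length < N :=
    ⟨T.sup List.length + 1, fun l hl => Nat.lt_succ_of_le (Finset.le_sup hl)⟩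
  have hfib (n : ℕ) : ∑ l ∈ T with l.length = n, z ^ l.length ≤ (1 / 2) ^ n := by
    have hcard : (T.filter fun l => l.length = n).card ≤ Fintype.card α ^ n := by
      have := Finset.card_le_card (s := T.filter fun l => l.length = n)
        (t := (Finset.univ : Finset (List.Vector α n)).map
          (⟨List.Vector.toList, List.Vector.toList_injective⟩ : List.Vector α n ↪ List α))
        fun l hl => Finset.mem_map.2 ⟨⟨l, (Finset.mem_filter.1 hl).2⟩, Finset.mem_univ _, rfl⟩
      rwa [Finset.card_map, Finset.card_univ, card_vector] at this
    calc ∑ l ∈ T with l.length = n, z ^ l.length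
        = ∑ l ∈ T with l.length = n, z ^ n :=
          Finset.sum_congr rfl fun l hl => by rw [(Finset.mem_filter.1 hl).2]
      _ = ((T.filter fun l => l.length = n).card : ℝ) * z ^ n := by
          rw [Finset.sum_const, nsmul_eq_mul]
      _ ≤ (Fintype.card α : ℝ) ^ n * z ^ n := by
          gcongr
          exact_mod_cast hcard
      _ = (z * Fintype.card α) ^ n := by rw [mul_pow, mul_comm]
      _ ≤ (1 / 2) ^ n := by gcongr
  rw [← Finset.sum_fiberwise_of_maps_to (t := Finset.range N) (g := List.length)
    (fun l hl => Finset.mem_range.2 (hN l hl))]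
  refine (Finset.sum_le_sum fun n _ => hfib n).trans ?_
  have := sum_geometric_two_le N
  simpa using this

theorem WeightRep.sum_exp_le {m : ℕ} [Fintype GB] {ω : ℕ → GB →* Equiv.Perm (Fin (m + 2))}
    {s : ℝ} (hs : Real.exp (-s) * Fintype.card (Equiv.Perm (Fin (m + 2)) × GB) ≤ 1 / 2)
    (hs0 : 0 ≤ s) (S : Finset (Equiv.Perm (List (Fin (m + 2)))))
    (c : Equiv.Perm (List (Fin (m + 2))) → ℝ)
    (hc : ∀ g ∈ S, WeightRep ω (fun _ => 1) (c g) g) :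
    ∑ g ∈ S, Real.exp (-s * c g) ≤ 2 * (m + 2).factorial := by
  classical
  choose! l e hg hl using hc
  calc ∑ g ∈ S, Real.exp (-s * c g)
      ≤ ∑ g ∈ S, Real.exp (-s) ^ (l g).length := by
        refine Finset.sum_le_sum fun g hgS => ?_
        rw [← Real.exp_nat_mul]
        have := hl g hgS
        simp only [List.map_const', List.sum_replicate, nsmul_eq_mul, mul_one] at this
        refine Real.exp_le_exp.2 ?_
        nlinarith
    _ = ∑ x ∈ S.image fun g => (e g, l g), Real.exp (-s) ^ x.2.length := by
        rw [Finset.sum_image]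
        intro g hgS g' hgS' heq
        simp only [Prod.mk.injEq] at heq
        rw [← hg g hgS, ← hg g' hgS', heq.1, heq.2]
    _ ≤ ∑ x ∈ (Finset.univ : Finset (Equiv.Perm (Fin (m + 2)))) ×ˢ S.image l,
          Real.exp (-s) ^ x.2.length := by
        refine Finset.sum_le_sum_of_subset_of_nonneg ?_ fun _ _ _ => by positivity
        intro x hx
        obtain ⟨g, hgS, rfl⟩ := Finset.mem_image.1 hx
        exact Finset.mem_product.2 ⟨Finset.mem_univ _, Finset.mem_image_of_mem l hgS⟩
    _ ≤ ∑ _x : Equiv.Perm (Fin (m + 2)), (2 : ℝ) := by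
        rw [Finset.sum_product]
        exact Finset.sum_le_sum fun _ _ => sum_pow_length_le (Real.exp_nonneg _) hs _
    _ = 2 * (m + 2).factorial := by
        simp [Fintype.card_perm, mul_comm]

theorem Decomposes.sum_exp_le {m : ℕ} {P : ℝ → Equiv.Perm (List (Fin (m + 2))) → Prop}
    {s Z : ℝ} (hs0 : 0 ≤ s)
    (hP : ∀ (S : Finset (Equiv.Perm (List (Fin (m + 2)))))
      (c : Equiv.Perm (List (Fin (m + 2))) → ℝ), (∀ g ∈ S, P (c g) g) →
      ∑ g ∈ S, Real.exp (-s * c g) ≤ Z) (d : ℕ)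
    (S : Finset (Equiv.Perm (List (Fin (m + 2)))))
    (c : Equiv.Perm (List (Fin (m + 2))) → ℝ) (hc : ∀ g ∈ S, Decomposes P d (c g) g) :
    (m + 2).factorial * ∑ g ∈ S, Real.exp (-s * c g) ≤
      ((m + 2).factorial * Z) ^ (m + 2) ^ d := by
  classical
  induction d generalizing S c with
  | zero => simpa using mul_le_mul_of_nonneg_left (hP S c hc) (Nat.cast_nonneg _)
  | succ d ih =>
    choose! σ h n hsec hn hdec using hc
    have hmin (y : Fin (m + 2)) (k : Equiv.Perm (List (Fin (m + 2)))) :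
        ∃ x : ℝ, k ∈ S.image (fun g => h g y) →
          Decomposes P d x k ∧ ∀ g ∈ S, h g y = k → x ≤ n g y := by
      by_cases hk : k ∈ S.image fun g => h g y
      · obtain ⟨g₀, hg₀, rfl⟩ := Finset.mem_image.1 hk
        obtain ⟨g₁, hg₁, hle⟩ := (S.filter fun g => h g y = h g₀ y).exists_min_image
          (fun g => n g y) ⟨g₀, Finset.mem_filter.2 ⟨hg₀, rfl⟩⟩
        obtain ⟨hg₁S, hg₁h⟩ := Finset.mem_filter.1 hg₁
        exact ⟨n g₁ y, fun _ => ⟨hg₁h ▸ hdec g₁ hg₁S y,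
          fun g hg hgh => hle g (Finset.mem_filter.2 ⟨hg, hgh⟩)⟩⟩
      · exact ⟨0, fun hk' => absurd hk' hk⟩
    choose x hx using hmin
    have hsum : ∑ g ∈ S, Real.exp (-s * c g) ≤ (m + 2).factorial *
        ∏ y, ∑ k ∈ S.image (fun g => h g y), Real.exp (-s * x y k) := by
      calc ∑ g ∈ S, Real.exp (-s * c g)
          ≤ ∑ g ∈ S, ∏ y, Real.exp (-s * x y (h g y)) := by
            refine Finset.sum_le_sum fun g hg => ?_
            rw [← Real.exp_sum, ← Finset.mul_sum]
            have h1 : ∑ y, x y (h g y) ≤ ∑ y, n g y := Finset.sum_le_sum fun y _ =>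
              (hx y _ (Finset.mem_image_of_mem _ hg)).2 g hg rfl
            refine Real.exp_le_exp.2 ?_
            nlinarith [hn g hg]
        _ = ∑ p ∈ S.image fun g => (σ g, h g), ∏ y, Real.exp (-s * x y (p.2 y)) := by
            rw [Finset.sum_image]
            intro g hg g' hg' heq
            simp only [Prod.mk.injEq] at heq
            refine (hsec g hg).unique ?_
            rw [heq.1, heq.2]
            exact hsec g' hg'
        _ ≤ ∑ p ∈ (Finset.univ : Finset (Equiv.Perm (Fin (m + 2)))) ×ˢ
              Fintype.piFinset (fun y => S.image fun g => h g y),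
              ∏ y, Real.exp (-s * x y (p.2 y)) := by
            refine Finset.sum_le_sum_of_subset_of_nonneg ?_ fun _ _ _ => by positivity
            intro p hp
            obtain ⟨g, hg, rfl⟩ := Finset.mem_image.1 hp
            exact Finset.mem_product.2 ⟨Finset.mem_univ _, Fintype.mem_piFinset.2 fun y =>
              Finset.mem_image_of_mem (fun g => h g y) hg⟩
        _ = _ := by
            rw [Finset.sum_product, Finset.prod_univ_sum]
            simp [Fintype.card_perm]
    have hF : (1 : ℝ) ≤ (m + 2).factorial := by exact_mod_cast Nat.factorial_pos (m + 2)
    have hprod : (0 : ℝ) ≤ ∏ y, ∑ k ∈ S.image (fun g => h g y), Real.exp (-s * x y k) := by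
      positivity
    calc ((m + 2).factorial : ℝ) * ∑ g ∈ S, Real.exp (-s * c g)
        ≤ (m + 2).factorial * ((m + 2).factorial *
            ∏ y, ∑ k ∈ S.image (fun g => h g y), Real.exp (-s * x y k)) := by gcongr
      _ = ((m + 2).factorial : ℝ) ^ 2 *
            ∏ y, ∑ k ∈ S.image (fun g => h g y), Real.exp (-s * x y k) := by ring
      _ ≤ ((m + 2).factorial : ℝ) ^ (m + 2) *
            ∏ y, ∑ k ∈ S.image (fun g => h g y), Real.exp (-s * x y k) := by
          gcongr
          omega
      _ = ∏ y, ((m + 2).factorial *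
            ∑ k ∈ S.image (fun g => h g y), Real.exp (-s * x y k)) := by
          rw [Finset.prod_mul_distrib]
          simp
      _ ≤ ∏ _y : Fin (m + 2), ((m + 2).factorial * Z) ^ (m + 2) ^ d := by
          refine Finset.prod_le_prod (fun _ _ => by positivity) fun y _ => ?_
          exact ih _ (x y) fun k hk => (hx y k hk).1
      _ = _ := by
          rw [Finset.prod_const, Finset.card_univ, Fintype.card_fin, ← pow_mul, pow_succ]

theorem genSet_inv_mem {m : ℕ} {GA : Subgroup (Equiv.Perm (Fin (m + 2)))}
    {ω : ℕ → GB →* Equiv.Perm (Fin (m + 2))} {g : Equiv.Perm (List (Fin (m + 2)))}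
    (hg : g⁻¹ ∈ genSet m GA ω) : g ∈ genSet m GA ω := by
  obtain ⟨h, h1⟩ := hg
  refine ⟨?_, by simpa using h1⟩
  rcases h with ⟨a, ha, hag⟩ | ⟨b, hbg⟩
  · refine Or.inl ⟨a⁻¹, GA.inv_mem ha, ?_⟩
    rw [eq_comm, ← inv_inv g, inv_eq_iff_mul_eq_one, ← hag, ← rootAut_mul, mul_inv_cancel,
      rootAut_one]
  · refine Or.inr ⟨b⁻¹, ?_⟩
    simp only at hbg ⊢
    have h1 : spinalAut m ω (1 : GB) = 1 := by
      have := spinalAut_mul m ω (1 : GB) 1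
      rwa [mul_one, left_eq_mul] at this
    rw [eq_comm, ← inv_inv g, inv_eq_iff_mul_eq_one, ← hbg, ← spinalAut_mul, mul_inv_cancel, h1]

theorem exists_list_of_wordLength_le {m : ℕ} {GA : Subgroup (Equiv.Perm (Fin (m + 2)))}
    {ω : ℕ → GB →* Equiv.Perm (Fin (m + 2))} {g : Equiv.Perm (List (Fin (m + 2)))} {n : ℕ}
    (hg : g ∈ spinalGroup m GA ω) (hn : wordLength (genSet m GA ω) g ≤ n) :
    ∃ l : List (Equiv.Perm (List (Fin (m + 2)))), l.length ≤ n ∧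
      (∀ x ∈ l, x ∈ genSet m GA ω) ∧ l.prod = g := by
  have hg' : g ∈ (Subgroup.closure (genSet m GA ω)).toSubmonoid := hg
  rw [Subgroup.closure_toSubmonoid] at hg'
  obtain ⟨l, hl, hprod⟩ := Submonoid.exists_list_of_mem_closure hg'
  have hne : {n | ∃ l : List (Equiv.Perm (List (Fin (m + 2)))), l.length = n ∧
      (∀ x ∈ l, x ∈ genSet m GA ω) ∧ l.prod = g}.Nonempty :=
    ⟨l.length, l, rfl, fun x hx => (hl x hx).elim id genSet_inv_mem, hprod⟩
  obtain ⟨l', hlen, hmem, hprod'⟩ := Nat.sInf_mem hne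
  exact ⟨l', hlen.trans_le hn, hmem, hprod'⟩

theorem weightRep_list_prod {m : ℕ} {GA : Subgroup (Equiv.Perm (Fin (m + 2)))}
    {ω : ℕ → GB →* Equiv.Perm (Fin (m + 2))} (l : List (Equiv.Perm (List (Fin (m + 2)))))
    (hl : ∀ x ∈ l, x ∈ genSet m GA ω) : WeightRep ω (fun _ => 1) l.length l.prod := by
  induction l with
  | nil => exact ⟨[], 1, by simp [altEval, rootAut_one], by simp⟩
  | cons x t ih =>
    obtain ⟨w, e, hw, hlen⟩ := ih fun y hy => hl y (List.mem_cons_of_mem x hy)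
    rw [List.prod_cons, ← hw, List.length_cons]
    push_cast
    rcases (hl x List.mem_cons_self).1 with ⟨a, -, rfl⟩ | ⟨b, rfl⟩
    · cases w with
      | nil =>
        refine ⟨[], a * e, by simp [altEval, rootAut_mul], ?_⟩
        simp only [List.map_nil, List.sum_nil] at hlen ⊢
        linarith
      | cons p w =>
        refine ⟨(a * p.1, p.2) :: w, e, by simp [altEval_cons, rootAut_mul, mul_assoc], ?_⟩
        simp only [List.map_cons, List.sum_cons] at hlen ⊢
        linarith
    · refine ⟨(1, b) :: w, e, by simp [altEval_cons, rootAut_one], ?_⟩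
      simp only [List.map_cons, List.sum_cons] at hlen ⊢
      linarith

theorem natCard_le_of_finset_card_le {α : Type*} {p : α → Prop} {x : ℝ} (hx : 0 ≤ x)
    (h : ∀ S : Finset α, (∀ g ∈ S, p g) → (S.card : ℝ) ≤ x) : (Nat.card {g // p g} : ℝ) ≤ x := by
  by_cases hfin : {g | p g}.Finite
  · have := h hfin.toFinset fun g hg => by simpa using hg
    rwa [← Set.ncard_eq_toFinset_card _ hfin] at this
  · have : Infinite {g // p g} := Set.infinite_coe_iff.2 hfin
    simpa using hx

theorem growth_zero_le_one (m : ℕ) (GA : Subgroup (Equiv.Perm (Fin (m + 2))))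
    (ω : ℕ → GB →* Equiv.Perm (Fin (m + 2))) : (growth m GA ω 0 : ℝ) ≤ 1 := by
  refine natCard_le_of_finset_card_le zero_le_one fun S hS => ?_
  have : S.card ≤ 1 := by
    refine Finset.card_le_one.2 fun g hg g' hg' => ?_
    obtain ⟨l, hl, -, rfl⟩ := exists_list_of_wordLength_le (hS g hg).1 (hS g hg).2
    obtain ⟨l', hl', -, rfl⟩ := exists_list_of_wordLength_le (hS g' hg').1 (hS g' hg').2
    rw [List.length_eq_zero_iff.1 (Nat.le_zero.1 hl), List.length_eq_zero_iff.1 (Nat.le_zero.1 hl')]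
  exact_mod_cast this

theorem exists_growth_le_exp (m : ℕ) (GA : Subgroup (Equiv.Perm (Fin (m + 2)))) [Finite GB]
    (ω : ℕ → GB →* Equiv.Perm (Fin (m + 2))) {t : ℕ → ℕ} (ht0 : t 0 = 0) (ht : StrictMono t)
    (hcomp : ∀ i : ℕ, ∀ b : GB, ∃ j, t i ≤ j ∧ j < t (i + 1) ∧ ω j b = 1) :
    ∃ s u : ℝ, 0 < s ∧ 0 ≤ u ∧ ∀ n L : ℕ, (growth m GA ω n : ℝ) ≤
      Real.exp (s * ((2 / 3) ^ L * n + 2 * (m + 2 : ℝ) ^ t L) + u * (m + 2 : ℝ) ^ t L) := by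
  have := Fintype.ofFinite GB
  set K : ℝ := ((Fintype.card (Equiv.Perm (Fin (m + 2)) × GB) : ℕ) : ℝ) with hK
  have hK1 : 1 ≤ K := by
    rw [hK]
    exact_mod_cast Fintype.card_pos
  have hF : (1 : ℝ) ≤ (m + 2).factorial := by exact_mod_cast Nat.factorial_pos (m + 2)
  set F : ℝ := ((m + 2).factorial : ℝ)
  have hY : 1 ≤ F * (2 * F) := by nlinarith
  refine ⟨Real.log (2 * K), Real.log (F * (2 * F)), Real.log_pos (by linarith),
    Real.log_nonneg hY, fun n L => ?_⟩
  set s := Real.log (2 * K) with hs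
  have hs0 : 0 ≤ s := Real.log_nonneg (by linarith)
  have hexp : Real.exp (-s) * K ≤ 1 / 2 := by
    rw [Real.exp_neg, hs, Real.exp_log (by linarith)]
    apply le_of_eq
    field_simp
  refine natCard_le_of_finset_card_le (Real.exp_nonneg _) fun S hS => ?_
  set M : ℝ := (2 / 3) ^ L * n + 2 * (m + 2 : ℝ) ^ t L with hM
  have hdec : ∀ g ∈ S,
      Decomposes (WeightRep (fun k => ω (k + t L)) (fun _ => 1)) (t L) M g := by
    intro g hg
    obtain ⟨l, hl, hmem, rfl⟩ := exists_list_of_wordLength_le (hS g hg).1 (hS g hg).2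
    have hrep := weightRep_list_prod l hmem
    exact (hrep.mono _ (n : ℝ) _ (by exact_mod_cast hl)).decomposes_factorable ht0 ht hcomp L
  have hcount := Decomposes.sum_exp_le hs0
    (fun S c hc => WeightRep.sum_exp_le (ω := fun k => ω (k + t L)) hexp hs0 S c hc)
    (t L) S (fun _ => M) hdec
  rw [Finset.sum_const, nsmul_eq_mul] at hcount
  have hpow : Real.exp (Real.log (F * (2 * F)) * (m + 2 : ℝ) ^ t L) =
      (F * (2 * F)) ^ (m + 2) ^ t L := by
    rw [Real.exp_mul, Real.exp_log (by linarith), ← Real.rpow_natCast _ ((m + 2) ^ t L)]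
    push_cast
    rfl
  rw [Real.exp_add, hpow]
  have hx : (0 : ℝ) ≤ S.card * Real.exp (-s * M) := by positivity
  calc (S.card : ℝ) = Real.exp (s * M) * (S.card * Real.exp (-s * M)) := by
        rw [mul_left_comm, ← Real.exp_add]
        simp
    _ ≤ Real.exp (s * M) * (F * (S.card * Real.exp (-s * M))) := by
        exact mul_le_mul_of_nonneg_left (le_mul_of_one_le_left hx hF) (Real.exp_nonneg _)
    _ ≤ _ := by gcongr

/-- 3/4-Estimate: if `ω ∈ Ω̂` is `r`-factorable, then `γ_ω(n) ≾ e^{n^α}` with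
`α = log(q^r) / (log(q^r) − log(3/4))`. -/
theorem spinalGroup_growth_upper_bound_factorable (m : ℕ)
    (GA : Subgroup (Equiv.Perm (Fin (m + 2))))
    {GB : Type*} [Group GB] [Finite GB] (ω : ℕ → GB →* Equiv.Perm (Fin (m + 2)))
    (hdata : SpinalData m GA ω) (r : ℕ)
    (hfact : ∃ t : ℕ → ℕ, t 0 = 0 ∧ StrictMono t ∧ (∀ i, t (i + 1) ≤ t i + r) ∧
      ∀ i : ℕ, ∀ b : GB, ∃ j, t i ≤ j ∧ j < t (i + 1) ∧ ω j b = 1) :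
    ∃ C : ℝ, 0 < C ∧ ∀ n : ℕ,
      (growth m GA ω n : ℝ) ≤
        Real.exp ((C * n) ^
          (Real.log ((m + 2 : ℝ) ^ r) /
            (Real.log ((m + 2 : ℝ) ^ r) - Real.log (3 / 4)))) := by
  obtain ⟨t, ht0, ht, htr, hcomp⟩ := hfact
  obtain ⟨s, u, hs, hu, hgrowth⟩ := exists_growth_le_exp m GA ω ht0 ht hcomp
  have hr : r ≠ 0 := by
    have := ht zero_lt_one
    have := htr 0
    simp only [zero_add] at this
    omega
  have htL (L : ℕ) : t L ≤ r * L := by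
    induction L with
    | zero => simp [ht0]
    | succ L ih => rw [mul_add_one]; linarith [htr L]
  have hq : (1 : ℝ) < m + 2 := by linarith [(Nat.cast_nonneg m : (0 : ℝ) ≤ m)]
  set Q : ℝ := (m + 2 : ℝ) ^ r with hQ
  have hQ1 : 1 < Q := one_lt_pow₀ hq hr
  set α : ℝ := Real.log Q / (Real.log Q - Real.log (3 / 4)) with hα
  set x : ℝ := 4 / 3 * Q with hx
  have hx1 : 1 < x := by rw [hx]; linarith
  have hlogx : Real.log x = Real.log Q - Real.log (3 / 4) := by
    rw [hx, ← Real.log_div (by linarith) (by norm_num)]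
    congr 1
    ring
  have hα0 : 0 < α := by
    rw [hα, ← hlogx]
    exact div_pos (Real.log_pos hQ1) (Real.log_pos hx1)
  have hxα : x ^ α = Q := by
    rw [Real.rpow_def_of_pos (by linarith), hα, ← hlogx,
      mul_div_cancel₀ _ (Real.log_pos hx1).ne', Real.exp_log (by linarith)]
  set c : ℝ := 3 * s + u with hc
  have hc0 : 0 < c := by positivity
  refine ⟨c ^ α⁻¹ * x, by positivity, fun n => ?_⟩
  rcases Nat.eq_zero_or_pos n with rfl | hn
  · simpa [Real.zero_rpow hα0.ne'] using growth_zero_le_one m GA ω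
  obtain ⟨L, hL1, hL2⟩ := exists_nat_pow_near (x := (n : ℝ)) (by exact_mod_cast hn) hx1
  refine (hgrowth n (L + 1)).trans (Real.exp_le_exp.2 ?_)
  have hlevel : (m + 2 : ℝ) ^ t (L + 1) ≤ Q ^ (L + 1) := by
    rw [hQ, ← pow_mul]
    exact pow_le_pow_right₀ hq.le (htL _)
  have hlen : (2 / 3 : ℝ) ^ (L + 1) * n ≤ Q ^ (L + 1) := by
    calc (2 / 3 : ℝ) ^ (L + 1) * n ≤ (3 / 4) ^ (L + 1) * x ^ (L + 1) := by
          refine mul_le_mul ?_ hL2.le (by positivity) (by positivity)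
          exact pow_le_pow_left₀ (by norm_num) (by norm_num) _
      _ = Q ^ (L + 1) := by
          rw [← mul_pow, hx]
          congr 1
          ring
  calc s * ((2 / 3) ^ (L + 1) * n + 2 * (m + 2 : ℝ) ^ t (L + 1)) + u * (m + 2 : ℝ) ^ t (L + 1)
      ≤ s * (Q ^ (L + 1) + 2 * Q ^ (L + 1)) + u * Q ^ (L + 1) := by gcongr
    _ = c * (x ^ α) ^ (L + 1) := by rw [hxα, hc]; ring
    _ = c * (x ^ (L + 1)) ^ α := by
        rw [← Real.rpow_natCast, ← Real.rpow_natCast, ← Real.rpow_mul (by positivity),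
          ← Real.rpow_mul (by positivity), mul_comm α]
    _ ≤ c * (x * n) ^ α := by
        gcongr
        rw [pow_succ, mul_comm]
        gcongr
    _ = (c ^ α⁻¹ * x * n) ^ α := by
        rw [mul_assoc (c ^ α⁻¹), Real.mul_rpow (x := c ^ α⁻¹) (by positivity) (by positivity),
          Real.rpow_inv_rpow hc0.le hα0.ne']
end Spinal
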